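/- Approximate source condition implies approximate variational inequality (case 0 < c₂ < 1): under the nonlinearity condition ‖F(u)−F(u†)−A(u−u†)‖ ≤ K‖F(u)−F(u†)‖^{c₁}·B(u)^{c₂} on M, with c₁ ∈ (0, 1−c₂], c₂ ∈ (0,1), ‖u−u†‖ ≤ K_ᾱ and ‖F(u)−F(u†)‖ ≤ (ρᾱ)^{1/p} on M, for all u ∈ M and r ≥ r₀ > 0: −ξ(u−u†) ≤ c₂·B(u) + β₂·r^{1/(1−c₂)}·‖F(u)−F(u†)‖^{c₁/(1−c₂)} + K_ᾱ·d̃(r), where β₂ := (1−c₂)K^{1/(1−c₂)} + (ρᾱ)^{(1−c₁−c₂)/(p(1−c₂))}·r₀^{−c₂/(1−c₂)}. -/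

import Mathlib

theorem stmt_19 {U V : Type*} [NormedAddCommGroup U] [NormedSpace ℝ U]
    [NormedAddCommGroup V] [NormedSpace ℝ V]
    (A : U →L[ℝ] V) (ξ : U →L[ℝ] ℝ) (udag : U) (M : Set U) (F : U → V) (B : U → ℝ)
    (K Kᾱ ρ ᾱ p c₁ c₂ r₀ : ℝ)
    (hK : 0 < K) (hKᾱ : 0 < Kᾱ) (hρ : 0 < ρ) (hᾱ : 0 < ᾱ) (hp : 0 < p) (hr₀ : 0 < r₀)
    (hc₂ : 0 < c₂) (hc₂' : c₂ < 1) (hc₁ : 0 < c₁) (hc₁' : c₁ ≤ 1 - c₂)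
    (hB : ∀ u ∈ M, 0 ≤ B u)
    (hnl : ∀ u ∈ M,
      ‖F u - F udag - A (u - udag)‖ ≤ K * ‖F u - F udag‖ ^ c₁ * B u ^ c₂)
    (hub : ∀ u ∈ M, ‖u - udag‖ ≤ Kᾱ)
    (hFb : ∀ u ∈ M, ‖F u - F udag‖ ≤ (ρ * ᾱ) ^ (1 / p))
    (dtil : ℝ → ℝ)
    (hdtil : ∀ r ≥ (0 : ℝ), ∃ η : V →L[ℝ] ℝ, ‖η‖ ≤ r ∧ ‖ξ - η.comp A‖ = dtil r) :
    ∀ u ∈ M, ∀ r ≥ r₀,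
      -ξ (u - udag) ≤
        c₂ * B u
          + ((1 - c₂) * K ^ (1 / (1 - c₂))
              + (ρ * ᾱ) ^ ((1 - c₁ - c₂) / (p * (1 - c₂))) * r₀ ^ (-(c₂ / (1 - c₂))))
            * r ^ (1 / (1 - c₂)) * ‖F u - F udag‖ ^ (c₁ / (1 - c₂))
          + Kᾱ * dtil r := by
  intro u hu r hr
  have hr0 : 0 < r := lt_of_lt_of_le hr₀ hr
  have hq : 0 < 1 - c₂ := by linarith
  have hρα : 0 < ρ * ᾱ := mul_pos hρ hᾱ
  obtain ⟨η, hη, hd⟩ := hdtil r hr0.le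
  have hN := hnl u hu
  have hX := hFb u hu
  have hBu := hB u hu
  have hU := hub u hu
  have e : -ξ (u - udag) = η (F u - F udag - A (u - udag)) - η (F u - F udag)
      - (ξ - η.comp A) (u - udag) := by
    have h1 : (ξ - η.comp A) (u - udag) = ξ (u - udag) - η (A (u - udag)) := rfl
    rw [h1, map_sub η (F u - F udag)]
    ring
  have a1 : η (F u - F udag - A (u - udag)) ≤ r * ‖F u - F udag - A (u - udag)‖ :=
    (le_abs_self _).trans ((η.le_opNorm _).trans (by gcongr))
  have a2 : -η (F u - F udag) ≤ r * ‖F u - F udag‖ :=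
    (neg_le_abs _).trans ((η.le_opNorm _).trans (by gcongr))
  have a3 : -(ξ - η.comp A) (u - udag) ≤ Kᾱ * dtil r := by
    refine (neg_le_abs _).trans (((ξ - η.comp A).le_opNorm _).trans ?_)
    rw [hd, mul_comm]
    have : 0 ≤ dtil r := hd ▸ norm_nonneg _
    gcongr
  generalize hx : ‖F u - F udag‖ = x at *
  have hx0 : 0 ≤ x := hx ▸ norm_nonneg _
  have a4 : r * ‖F u - F udag - A (u - udag)‖ ≤ c₂ * B u
      + (1 - c₂) * (K ^ (1 / (1 - c₂)) * r ^ (1 / (1 - c₂)) * x ^ (c₁ / (1 - c₂))) := by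
    have hb : 0 ≤ K * r * x ^ c₁ := by positivity
    have y := Real.geom_mean_le_arith_mean2_weighted hc₂.le hq.le hBu
      (Real.rpow_nonneg hb (1 / (1 - c₂))) (by ring)
    rw [← Real.rpow_mul hb, one_div_mul_cancel hq.ne', Real.rpow_one,
      Real.mul_rpow (by positivity) (by positivity), Real.mul_rpow hK.le hr0.le,
      ← Real.rpow_mul hx0, mul_one_div] at y
    refine le_trans ?_ y
    calc _ ≤ r * (K * x ^ c₁ * B u ^ c₂) := by gcongr
      _ = _ := by ring
  have a5 : r * x ≤ ((ρ * ᾱ) ^ ((1 - c₁ - c₂) / (p * (1 - c₂))) * r₀ ^ (-(c₂ / (1 - c₂))))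
      * r ^ (1 / (1 - c₂)) * x ^ (c₁ / (1 - c₂)) := by
    rcases hx0.eq_or_lt with h | h
    · rw [← h, mul_zero]
      positivity
    have b1 : x = x ^ ((1 - c₁ - c₂) / (1 - c₂)) * x ^ (c₁ / (1 - c₂)) := by
      rw [← Real.rpow_add h, ← add_div, show 1 - c₁ - c₂ + c₁ = 1 - c₂ by ring,
        div_self hq.ne', Real.rpow_one]
    have b2 : r = r ^ (-(c₂ / (1 - c₂))) * r ^ (1 / (1 - c₂)) := by
      rw [← Real.rpow_add hr0, ← neg_div, ← add_div, show -c₂ + 1 = 1 - c₂ by ring,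
        div_self hq.ne', Real.rpow_one]
    have b3 : x ^ ((1 - c₁ - c₂) / (1 - c₂)) ≤ (ρ * ᾱ) ^ ((1 - c₁ - c₂) / (p * (1 - c₂))) := by
      have := Real.rpow_le_rpow hx0 hX (z := (1 - c₁ - c₂) / (1 - c₂))
        (div_nonneg (by linarith) hq.le)
      rwa [← Real.rpow_mul hρα.le, div_mul_div_comm, one_mul] at this
    have b4 : r ^ (-(c₂ / (1 - c₂))) ≤ r₀ ^ (-(c₂ / (1 - c₂))) :=
      Real.rpow_le_rpow_of_nonpos hr₀ hr (neg_nonpos.2 (div_nonneg hc₂.le hq.le))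
    calc r * x = (x ^ ((1 - c₁ - c₂) / (1 - c₂)) * r ^ (-(c₂ / (1 - c₂))))
          * r ^ (1 / (1 - c₂)) * x ^ (c₁ / (1 - c₂)) := by
            conv_lhs => rw [b1, b2]
            ring
      _ ≤ _ := by gcongr
  rw [e]
  linarith
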